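/- arXiv:math/0605138 — 2 statements merged into one kernel-verified Lean document; each statement's English description precedes it below -/
import Mathlib

section
/- Let A be a subset of Baire space and let f : A → (ℕ → ℕ) be continuous with respect to the subspace topology on A. Then there exists a continuous function g : (ℕ → ℕ) → (ℕ → Option ℕ) (where Option ℕ is discrete and the codomain carries the product topology) such that for every x ∈ A: the set {m | g x m ≠ none} is infinite, and if m₀ < m₁ < m₂ < … enumerates this set in increasing order, then g x m_k = some (f x k) for every k. That is, every partial continuous function on Baire space extends to a total continuous function whose output, after discarding the 'whitespace' values none, equals the original output. -/
/-- The discrete topology on `Option ℕ`. -/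
instance : TopologicalSpace (Option ℕ) := ⊥

instance : DiscreteTopology (Option ℕ) := ⟨rfl⟩

namespace WS

/-- `v` is the value of the `k`-th output for all points of `A` sharing the first `m` entries. -/
def P (A : Set (ℕ → ℕ)) (f : A → (ℕ → ℕ)) (x : ℕ → ℕ) (m k v : ℕ) : Prop :=
  ∀ y : A, (∀ i < m, y.1 i = x i) → f y k = v

open Classical in
/-- number of outputs before step `m` -/
noncomputable def c (A : Set (ℕ → ℕ)) (f : A → (ℕ → ℕ)) (x : ℕ → ℕ) : ℕ → ℕ
  | 0 => 0
  | m + 1 => c A f x m + if ∃ v, P A f x m (c A f x m) v then 1 else 0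

open Classical in
/-- the total function -/
noncomputable def g (A : Set (ℕ → ℕ)) (f : A → (ℕ → ℕ)) (x : ℕ → ℕ) (m : ℕ) : Option ℕ :=
  if ∃ v, P A f x m (c A f x m) v then
    some (Classical.epsilon (fun v => P A f x m (c A f x m) v)) else none

theorem P_congr (A : Set (ℕ → ℕ)) (f : A → (ℕ → ℕ)) (x x' : ℕ → ℕ) (m : ℕ)
    (h : ∀ i < m, x' i = x i) : P A f x' m = P A f x m := by
  funext k v
  unfold P
  apply propext
  constructor
  · intro H y hy
    exact H y fun i hi => (hy i hi).trans (h i hi).symm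
  · intro H y hy
    exact H y fun i hi => (hy i hi).trans (h i hi)

theorem c_congr (A : Set (ℕ → ℕ)) (f : A → (ℕ → ℕ)) (x x' : ℕ → ℕ) (m : ℕ)
    (h : ∀ i < m, x' i = x i) : c A f x' m = c A f x m := by
  induction m with
  | zero => rfl
  | succ m ih =>
    have h' : ∀ i < m, x' i = x i := fun i hi => h i (by omega)
    rw [c, c, ih h', P_congr A f x x' m h']

theorem g_congr (A : Set (ℕ → ℕ)) (f : A → (ℕ → ℕ)) (x x' : ℕ → ℕ) (m : ℕ)
    (h : ∀ i < m, x' i = x i) : g A f x' m = g A f x m := by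
  rw [g, g, c_congr A f x x' m h, P_congr A f x x' m h]

theorem g_ne (A : Set (ℕ → ℕ)) (f : A → (ℕ → ℕ)) (x : ℕ → ℕ) (m : ℕ) :
    g A f x m ≠ none ↔ ∃ v, P A f x m (c A f x m) v := by
  unfold g
  split_ifs with h <;> simp [h]

theorem g_val (A : Set (ℕ → ℕ)) (f : A → (ℕ → ℕ)) (x : ℕ → ℕ) (hx : x ∈ A) (m : ℕ)
    (h : g A f x m ≠ none) : g A f x m = some (f ⟨x, hx⟩ (c A f x m)) := by
  have h' := (g_ne A f x m).1 h
  unfold g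
  rw [if_pos h']
  have := Classical.epsilon_spec h' ⟨x, hx⟩ (fun _ _ => rfl)
  rw [this]

theorem g_cont (A : Set (ℕ → ℕ)) (f : A → (ℕ → ℕ)) : Continuous (g A f) := by
  refine continuous_pi fun m => IsLocallyConstant.continuous ?_
  rw [IsLocallyConstant.iff_eventually_eq]
  intro x
  have : ∀ᶠ y in nhds x, ∀ i ∈ Finset.range m, y i = x i := by
    rw [Filter.eventually_all_finset]
    intro i _
    have := (continuous_apply (A := fun _ : ℕ => ℕ) i).continuousAt (x := x)
    exact this.eventually (p := fun z => z = x i) (by simp)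
  filter_upwards [this] with y hy
  exact g_congr A f x y m fun i hi => hy i (Finset.mem_range.2 hi)

theorem count_eq (A : Set (ℕ → ℕ)) (f : A → (ℕ → ℕ)) (x : ℕ → ℕ)
    [DecidablePred fun m => g A f x m ≠ none] (m : ℕ) :
    Nat.count (fun m => g A f x m ≠ none) m = c A f x m := by
  induction m with
  | zero => simp [c]
  | succ m ih =>
    rw [Nat.count_succ, ih, c]
    have := g_ne A f x m
    by_cases h : g A f x m ≠ none
    · rw [if_pos h, if_pos (this.1 h)]
    · rw [if_neg h, if_neg (fun h' => h (this.2 h'))]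

theorem modulus (A : Set (ℕ → ℕ)) (f : A → (ℕ → ℕ)) (hf : Continuous f) (x : ℕ → ℕ)
    (hx : x ∈ A) (k : ℕ) : ∃ n, ∀ m ≥ n, P A f x m k (f ⟨x, hx⟩ k) := by
  have ho : IsOpen {y : A | f y k = f ⟨x, hx⟩ k} :=
    (isOpen_discrete {f ⟨x, hx⟩ k}).preimage ((continuous_apply k).comp hf)
  obtain ⟨U, hU, hUe⟩ := isOpen_induced_iff.1 ho
  have hxU : x ∈ U := by
    have : (⟨x, hx⟩ : A) ∈ Subtype.val ⁻¹' U := by rw [hUe]; simp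
    exact this
  obtain ⟨I, u, hu, hs⟩ := isOpen_pi_iff.1 hU x hxU
  refine ⟨I.sup id + 1, fun m hm y hy => ?_⟩
  have : y ∈ Subtype.val ⁻¹' U := by
    apply hs
    intro i hi
    have : i ≤ I.sup id := Finset.le_sup (f := id) hi
    rw [hy i (by omega)]
    exact (hu i hi).2
  rw [hUe] at this
  exact this

theorem inf (A : Set (ℕ → ℕ)) (f : A → (ℕ → ℕ)) (hf : Continuous f) (x : ℕ → ℕ)
    (hx : x ∈ A) : {m : ℕ | g A f x m ≠ none}.Infinite := by
  rw [Set.infinite_iff_exists_gt]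
  by_contra! H
  obtain ⟨N, hN⟩ := H
  have hN' : ∀ m > N, ¬ ∃ v, P A f x m (c A f x m) v := fun m hm h =>
    absurd (hN m ((g_ne A f x m).2 h)) (by omega)
  have hc : ∀ j, c A f x (N + 1 + j) = c A f x (N + 1) := by
    intro j
    induction j with
    | zero => rfl
    | succ j ih =>
      rw [← add_assoc, c, if_neg (hN' _ (by omega)), ih, add_zero]
  obtain ⟨n, hn⟩ := modulus A f hf x hx (c A f x (N + 1))
  apply hN' (N + 1 + n) (by omega)
  rw [hc]
  exact ⟨_, hn _ (by omega)⟩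

end WS

/-- Every continuous partial function on Baire space (continuous function on a subset
`A` of Baire space) extends to a total continuous function into `ℕ → Option ℕ` whose
output on points of `A`, after discarding the "whitespace" values `none`, equals the
original output: on each `x ∈ A` the set of positions carrying a value is infinite, and
the `k`-th such position (in increasing order) carries `some (f x k)`. -/
theorem partial_continuous_extends_total_with_whitespace
    (A : Set (ℕ → ℕ)) (f : A → (ℕ → ℕ)) (hf : Continuous f) :
    ∃ g : (ℕ → ℕ) → (ℕ → Option ℕ), Continuous g ∧
      ∀ (x : ℕ → ℕ) (hx : x ∈ A),
        {m : ℕ | g x m ≠ none}.Infinite ∧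
        ∀ k : ℕ, g x (Nat.nth (fun m => g x m ≠ none) k) = some (f ⟨x, hx⟩ k) := by
  classical
  refine ⟨WS.g A f, WS.g_cont A f, fun x hx => ?_⟩
  have hi := WS.inf A f hf x hx
  refine ⟨hi, fun k => ?_⟩
  have h1 := Nat.nth_mem_of_infinite hi k
  have h2 := Nat.count_nth_of_infinite hi k
  rw [WS.g_val A f x hx _ h1]
  have h3 := WS.count_eq A f x (Nat.nth (fun m => WS.g A f x m ≠ none) k)
  rw [← h3]
  congr 2
end

section
/- Define R : ℕ → ℕ → Prop by R n i ↔ i is not in the domain of the n-th partial computable function (under the standard numbering of partial computable functions ℕ →. ℕ), so that R is a universal Π⁰₁ predicate. Encode a finite Boolean combination of the atoms {R n 0, R n 1, R n 2, …} in disjunctive normal form as a list of clauses, where each clause is a list of literals (i, b) ∈ ℕ × Bool; such a combination evaluates to true under an assignment g : ℕ → Prop iff some clause has all its literals (i, b) satisfied, meaning g i ↔ (b = true). Then there is no total computable function F : ℕ → List (List (ℕ × Bool)) such that for every n: (i) F n evaluates to true under the assignment i ↦ R n i, and (ii) F n is not a tautology, i.e., some assignment g : ℕ → Bool makes F n evaluate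 to false. -/
/-- Evaluation of a finite Boolean combination in disjunctive normal form:
`φ` is a list of clauses, each clause a list of literals `(i, b)`; the combination is
true under the assignment `g` iff some clause has all its literals satisfied, a literal
`(i, b)` being satisfied when `g i ↔ b = true`. -/
def EvalDNF (g : ℕ → Prop) (φ : List (List (ℕ × Bool))) : Prop :=
  ∃ c ∈ φ, ∀ p ∈ c, (g p.1 ↔ p.2 = true)

/-- The universal `Π⁰₁` predicate: `UnivPi01 n i` holds iff `i` is not in the domain of
the `n`-th partial computable function (under the standard numbering). -/
def UnivPi01 (n i : ℕ) : Prop :=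
  ¬ ((Denumerable.ofNat Nat.Partrec.Code n).eval i).Dom

theorem mem_list_primrecRel : PrimrecRel fun (S : List ℕ) (i : ℕ) => i ∈ S := by
  have h : PrimrecRel fun (a b : ℕ) => a = b := Primrec.eq
  exact h.exists_mem_list.of_eq (by simp)

theorem evalDNF_primrecRel :
    PrimrecRel fun (φ : List (List (ℕ × Bool))) (S : List ℕ) => EvalDNF (fun i => i ∈ S) φ := by
  have h : PrimrecRel fun (p : ℕ × Bool) (S : List ℕ) => (p.1 ∈ S ↔ p.2 = true) := by
    have h1 : PrimrecPred fun q : (ℕ × Bool) × List ℕ => q.1.1 ∈ q.2 :=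
      PrimrecRel.comp mem_list_primrecRel Primrec.snd (Primrec.fst.comp Primrec.fst)
    have h2 : PrimrecPred fun q : (ℕ × Bool) × List ℕ => q.1.2 = true :=
      PrimrecRel.comp Primrec.eq (Primrec.snd.comp Primrec.fst) (Primrec.const true)
    exact ((h1.and h2).or (h1.not.and h2.not)).of_eq (by intro q; tauto)
  exact h.forall_mem_list.exists_mem_list

theorem evalDNF_congr {g g' : ℕ → Prop} {φ : List (List (ℕ × Bool))}
    (h : ∀ c ∈ φ, ∀ p ∈ c, (g p.1 ↔ g' p.1)) : EvalDNF g φ ↔ EvalDNF g' φ := by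
  unfold EvalDNF
  constructor
  · rintro ⟨c, hc, H⟩
    exact ⟨c, hc, fun p hp => (h c hc p hp).symm.trans (H p hp)⟩
  · rintro ⟨c, hc, H⟩
    exact ⟨c, hc, fun p hp => (h c hc p hp).trans (H p hp)⟩

/-- No total computable function can produce, for every `n`, a finite Boolean
combination (in DNF) of the atoms `{R n 0, R n 1, …}` of the universal `Π⁰₁`
predicate `R = UnivPi01` that is both true (under `i ↦ R n i`) and not a tautology. -/
theorem no_computable_true_nontautological_combination :
    ¬ ∃ F : ℕ → List (List (ℕ × Bool)), Computable F ∧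
      ∀ n : ℕ,
        EvalDNF (fun i => UnivPi01 n i) (F n) ∧
        ∃ g : ℕ → Bool, ¬ EvalDNF (fun i => g i = true) (F n) := by

  classical
  rintro ⟨F, hF, H⟩
  let G : Nat.Partrec.Code → List (List (ℕ × Bool)) := fun c => F (Encodable.encode c)
  have hG : Computable G := hF.comp Computable.encode
  let t : Nat.Partrec.Code → ℕ → Bool := fun c k =>
    !decide (EvalDNF (fun i => i ∈ Denumerable.ofNat (List ℕ) k) (G c))
  have ht : Computable₂ t := by
    have h1 := evalDNF_primrecRel.decide.to_comp
    exact Primrec.not.to_comp.comp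
      (h1.comp (hG.comp Computable.fst) ((Computable.ofNat (List ℕ)).comp Computable.snd))
  have hr : Partrec fun c => Nat.rfind (fun k => Part.some (t c k)) :=
    Partrec.rfind ht.partrec₂
  let o : ℕ → ℕ → Option ℕ := fun i k =>
    bif decide (i ∈ Denumerable.ofNat (List ℕ) k) then none else some 0
  have ho : Computable₂ o := by
    have h1 := mem_list_primrecRel.decide.to_comp
    exact Computable.cond
      (h1.comp ((Computable.ofNat (List ℕ)).comp Computable.snd) Computable.fst)
      (Computable.const none) (Computable.const (some 0))
  let f : Nat.Partrec.Code → ℕ →. ℕ := fun c i =>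
    (Nat.rfind (fun k => Part.some (t c k))).bind fun k => (o i k : Part ℕ)
  have hf : Partrec₂ f := by
    refine Partrec.bind (hr.comp Computable.fst) ?_
    exact Computable.ofOption
      (ho.comp (Computable.snd.comp Computable.fst) Computable.snd)
  obtain ⟨c, hc⟩ := Nat.Partrec.Code.fixed_point₂ hf
  obtain ⟨h1, g, hg⟩ := H (Encodable.encode c)
  -- the search terminates
  have hex : ∃ k, t c k = true := by
    refine ⟨Encodable.encode (((G c).flatten.map Prod.fst).filter fun i => g i), ?_⟩
    simp only [t, Denumerable.ofNat_encode, Bool.not_eq_true', decide_eq_false_iff_not]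
    intro h
    apply hg
    refine (evalDNF_congr ?_).1 h
    intro d hd p hp
    simp only [List.mem_filter, List.mem_map, List.mem_flatten]
    exact ⟨fun h => h.2, fun h => ⟨⟨p, ⟨d, hd, hp⟩, rfl⟩, h⟩⟩
  obtain ⟨m, hm⟩ := hex
  obtain ⟨k, hk, -⟩ := Nat.rfind_min' hm
  have hkt : t c k = true := by
    have := Nat.rfind_spec hk
    simpa using this
  have hk' : ¬ EvalDNF (fun i => i ∈ Denumerable.ofNat (List ℕ) k) (G c) := by
    simpa [t] using hkt
  apply hk'
  refine (evalDNF_congr ?_).1 h1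
  intro d _ p _
  have hfe : f c p.1 = (o p.1 k : Part ℕ) := by
    have e : Nat.rfind (fun k => Part.some (t c k)) = Part.some k := Part.eq_some_iff.2 hk
    exact (congrArg (fun x : Part ℕ => x.bind fun k => (o p.1 k : Part ℕ)) e).trans
      (Part.bind_some _ _)
  simp only [UnivPi01, Denumerable.ofNat_encode, hc, hfe, o]
  by_cases hp : p.1 ∈ Denumerable.ofNat (List ℕ) k <;> simp [hp]
end
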